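/- Let M be a countable transitive set with (M,∈) ⊨ ZF ∪ {AC}, let ⟨P,≼,𝟙⟩ ∈ M be a forcing notion, and let G be an M-generic filter on P. Then (M[G],∈) ⊨ AC. -/

import Mathlib

namespace CtmForcing

open FirstOrder FirstOrder.Language

/-! ### The first-order language of set theory -/

/-- The relation symbols of the language of set theory: a single binary relation `∈`. -/
inductive memRel : ℕ → Type
  | mem : memRel 2

/-- The first-order language `L` of set theory, with a single binary relation symbol `∈`. -/
def SetLang : Language := ⟨fun _ => Empty, memRel⟩

/-- The membership relation symbol. -/
abbrev memSymb : SetLang.Relations 2 := .mem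

/-- `L`-formulas (with no free "unbounded" variables) whose free variables are among
`v₀, …, v_{n-1}`. -/
abbrev BF (n : ℕ) := SetLang.BoundedFormula Empty n

/-- The atomic formula `vᵢ ∈ vⱼ`. -/
def memf {n : ℕ} (i j : Fin n) : BF n :=
  memSymb.boundedFormula₂ (Term.var (Sum.inr i)) (Term.var (Sum.inr j))

/-- The atomic formula `vᵢ = vⱼ`. -/
def eqf {n : ℕ} (i j : Fin n) : BF n :=
  Term.bdEqual (Term.var (Sum.inr i)) (Term.var (Sum.inr j))

/-- Rename the free variables of a formula along `f`. -/
def reindex {m k : ℕ} (f : Fin m → Fin k) (φ : BF m) : BF k :=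
  (BoundedFormula.relabel (Sum.map id f) φ.toFormula : SetLang.BoundedFormula Empty (k + 0))

/-- Conjunction. -/
def andF {n : ℕ} (φ ψ : BF n) : BF n := (φ.imp ψ.not).not

/-- Disjunction. -/
def orF {n : ℕ} (φ ψ : BF n) : BF n := (φ.not).imp ψ

/-- Biimplication. -/
def iffF {n : ℕ} (φ ψ : BF n) : BF n := andF (φ.imp ψ) (ψ.imp φ)

/-! ### Basic set-theoretic formulas -/

/-- `v₀ ⊆ v₁`. -/
def subF : BF 2 := ((memf 2 0).imp (memf 2 1)).all

/-- `v₀ = ∅`. -/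
def emptyF : BF 1 := ((memf 1 0).not).all

/-- `v₂ = {v₀, v₁}`. -/
def pairSetF : BF 3 := (iffF (memf 3 2) (orF (eqf 3 0) (eqf 3 1))).all

/-- `v₁ = {v₀}`. -/
def singF : BF 2 := reindex ![0, 0, 1] pairSetF

/-- `v₂ = ⟨v₀, v₁⟩` (Kuratowski ordered pair). -/
def opF : BF 3 :=
  (iffF (memf 3 2) (orF (reindex ![0, 3] singF) (reindex ![0, 1, 3] pairSetF))).all

/-- `v₁ = v₀ ∪ {v₀}`. -/
def succF : BF 2 := (iffF (memf 2 1) (orF (memf 2 0) (eqf 2 0))).all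

/-- `v₀` is transitive. -/
def transF : BF 1 := ((memf 1 0).imp (reindex ![1, 0] subF)).all

/-- `v₀` is an ordinal (a transitive set of transitive sets). -/
def ordF : BF 1 := andF transF (((memf 1 0).imp (reindex ![1] transF)).all)

/-- `⟨v₀, v₁⟩ ∈ v₂`. -/
def relMemF : BF 3 := (andF (reindex ![0, 1, 3] opF) (memf 3 2)).ex

/-- `v₂` is a function with domain `v₀` mapping onto `v₁` (a surjection from `v₀` onto `v₁`). -/
def isFuncF : BF 3 :=
  andF
    (andF
      -- v₂ ⊆ v₀ × v₁
      (((memf 3 2).imp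
        (((andF (andF (memf 4 0) (memf 5 1)) (reindex ![4, 5, 3] opF)).ex).ex)).all)
      -- total on v₀
      (((memf 3 0).imp ((andF (memf 4 1) (reindex ![3, 4, 2] relMemF)).ex)).all))
    (andF
      -- functional
      ((((andF (reindex ![3, 4, 2] relMemF) (reindex ![3, 5, 2] relMemF)).imp
          (eqf 4 5)).all).all.all)
      -- onto v₁
      (((memf 3 1).imp ((andF (memf 4 0) (reindex ![4, 3, 2] relMemF)).ex)).all))

/-- `v₂` is injective (as a set of ordered pairs). -/
def injF : BF 3 :=
  ((((andF (reindex ![3, 5, 2] relMemF) (reindex ![4, 5, 2] relMemF)).imp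
      (eqf 3 4)).all).all).all

/-- `v₂` is a bijection from `v₀` onto `v₁`. -/
def bijF : BF 3 := andF isFuncF injF

/-! ### The axioms of set theory as `L`-sentences -/

/-- Extensionality. -/
def extAx : SetLang.Sentence :=
  ((((andF subF (reindex ![1, 0] subF)).imp (eqf 0 1)).all).all : BF 0)

/-- Foundation. -/
def foundAx : SetLang.Sentence :=
  (((((memf 1 0).ex).imp
    ((andF (memf 1 0) (((memf 2 0).imp ((memf 2 1).not)).all)).ex)).all) : BF 0)

/-- Pairing. -/
def pairAx : SetLang.Sentence := (((pairSetF.ex).all).all : BF 0)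

/-- Union. -/
def unionAx : SetLang.Sentence :=
  (((((iffF (memf 2 1) ((andF (memf 3 0) (memf 2 3)).ex)).all).ex).all : BF 0))

/-- Powerset. -/
def powF : BF 2 := (iffF (memf 2 1) (reindex ![2, 0] subF)).all

/-- Powerset axiom. -/
def powAx : SetLang.Sentence := (((powF.ex).all) : BF 0)

/-- Infinity. -/
def infAx : SetLang.Sentence :=
  (((andF ((andF (memf 1 0) (reindex ![1] emptyF)).ex)
    (((memf 1 0).imp ((andF (memf 2 0) (reindex ![1, 2] succF)).ex)).all)).ex) : BF 0)

/-- The instance of the Separation scheme given by `φ`, whose free variables are among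
`v₀, …, vₙ`: the parameters are `v₀, …, v_{n-1}` and the tested element is `vₙ`.  It is the
universal closure of `∀A ∃B ∀x (x ∈ B ↔ x ∈ A ∧ φ(params, x))`. -/
def sepAx {n : ℕ} (φ : BF (n + 1)) : SetLang.Sentence :=
  -- context `n+3`: parameters `0,…,n-1`, `A = n`, `B = n+1`, `x = n+2`
  let A : Fin (n + 3) := ⟨n, by omega⟩
  let B : Fin (n + 3) := ⟨n + 1, by omega⟩
  let x : Fin (n + 3) := ⟨n + 2, by omega⟩
  let φ' : BF (n + 3) := reindex (fun i => if h : (i : ℕ) < n then ⟨i, by omega⟩ else x) φ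
  ((((iffF (memf x B) (andF (memf x A) φ')).all).ex).all).alls

/-- The instance of the Replacement scheme given by `φ`, whose free variables are among
`v₀, …, v_{n+1}`: the parameters are `v₀, …, v_{n-1}`, the argument is `x = vₙ`, and the
value is `y = v_{n+1}`.  It is the universal closure of
`∀A [(∀x∈A ∀y ∀y' (φ(x,y) ∧ φ(x,y') → y = y')) → ∃B ∀y (y ∈ B ↔ ∃x∈A φ(x,y))]`. -/
def replAx {n : ℕ} (φ : BF (n + 2)) : SetLang.Sentence :=
  -- functionality context `n+4`: parameters, `A = n`, `x = n+1`, `y = n+2`, `y' = n+3`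
  let A : Fin (n + 4) := ⟨n, by omega⟩
  let x : Fin (n + 4) := ⟨n + 1, by omega⟩
  let y : Fin (n + 4) := ⟨n + 2, by omega⟩
  let y' : Fin (n + 4) := ⟨n + 3, by omega⟩
  let φ₁ : BF (n + 4) :=
    reindex (fun i => if h : (i : ℕ) < n then ⟨i, by omega⟩ else if (i : ℕ) = n then x else y) φ
  let φ₂ : BF (n + 4) :=
    reindex (fun i => if h : (i : ℕ) < n then ⟨i, by omega⟩ else if (i : ℕ) = n then x else y') φ
  let funcl : BF (n + 1) :=
    ((((andF (memf x A) (andF φ₁ φ₂)).imp (eqf y y')).all).all).all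
  -- image context `n+4`: parameters, `A = n`, `B = n+1`, `y = n+2`, `x = n+3`
  let xi : Fin (n + 4) := ⟨n + 3, by omega⟩
  let yi : Fin (n + 4) := ⟨n + 2, by omega⟩
  let B3 : Fin (n + 3) := ⟨n + 1, by omega⟩
  let y3 : Fin (n + 3) := ⟨n + 2, by omega⟩
  let φ₃ : BF (n + 4) :=
    reindex (fun i => if h : (i : ℕ) < n then ⟨i, by omega⟩ else if (i : ℕ) = n then xi else yi) φ
  let image : BF (n + 1) :=
    (((iffF (memf y3 B3) ((andF (memf xi A) φ₃).ex)).all).ex)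
  ((funcl.imp image).all).alls

/-- The Axiom of Choice: every set is the surjective image of an ordinal. -/
def acAx : SetLang.Sentence :=
  ((((andF (reindex ![1] ordF) (reindex ![1, 0, 2] isFuncF)).ex).ex).all : BF 0)

/-- `v₀ = ω`: `v₀` is an ordinal containing `∅`, closed under successors, each of whose
elements is `∅` or a successor. -/
def omegaF : BF 1 :=
  andF (andF ordF ((andF (memf 1 0) (reindex ![1] emptyF)).ex))
    (andF (((memf 1 0).imp ((andF (memf 2 0) (reindex ![1, 2] succF)).ex)).all)
      (((memf 1 0).imp
        (orF (reindex ![1] emptyF) ((andF (memf 2 1) (reindex ![2, 1] succF)).ex))).all))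

/-- Given `v₀ = ω`, `v₁ = ℵ₁`: `v₁` is an ordinal, there is no surjection from `ω` onto `v₁`,
and every element of `v₁` is empty or a surjective image of `ω`. -/
def alephOneF : BF 2 :=
  andF (andF (reindex ![1] ordF) (((reindex ![0, 1, 2] isFuncF).ex).not))
    (((memf 2 1).imp (orF (reindex ![2] emptyF) ((reindex ![0, 2, 3] isFuncF).ex))).all)

/-- The Continuum Hypothesis `ℵ₁ = 2^ℵ₀`: there is a bijection between `𝒫(ω)` and `ℵ₁`. -/
def chSent : SetLang.Sentence :=
  (((((andF (andF (reindex ![0] omegaF) (reindex ![0, 1] powF))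
      (andF (reindex ![0, 2] alephOneF) (reindex ![1, 2, 3] bijF))).ex).ex).ex).ex : BF 0)

/-! ### The theories `Z`, `ZF`, `ZC`, `ZFC` -/

/-- The finitely many non-scheme axioms of `ZF`. -/
def zfFin : SetLang.Theory := {extAx, foundAx, pairAx, unionAx, powAx, infAx}

/-- All instances of the Separation scheme. -/
def sepScheme : SetLang.Theory := Set.range fun p : Σ n, BF (n + 1) => sepAx p.2

/-- All instances of the Replacement scheme. -/
def replScheme : SetLang.Theory := Set.range fun p : Σ n, BF (n + 2) => replAx p.2

/-- Zermelo set theory. -/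
def Z : SetLang.Theory := zfFin ∪ sepScheme

/-- Zermelo–Fraenkel set theory. -/
def ZF : SetLang.Theory := Z ∪ replScheme

/-- Zermelo set theory with Choice. -/
def ZC : SetLang.Theory := Z ∪ {acAx}

/-- Zermelo–Fraenkel set theory with Choice. -/
def ZFC : SetLang.Theory := ZF ∪ {acAx}

/-! ### Satisfaction in a set with the true membership relation -/

/-- The `L`-structure on (the elements of) a `ZFSet` `M`, with `∈` interpreted as true
membership. -/
def zfStruct (M : ZFSet) : SetLang.Structure {x : ZFSet // x ∈ M} where
  funMap := fun f _ => f.elim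
  RelMap | .mem => fun v => ((v 0 : {x : ZFSet // x ∈ M}) : ZFSet) ∈ ((v 1 : {x : ZFSet // x ∈ M}) : ZFSet)

/-- `(M, ∈) ⊨ T`: the structure on `M` with true membership satisfies every sentence of `T`. -/
def ZModels (M : ZFSet) (T : SetLang.Theory) : Prop :=
  ∀ φ ∈ T, letI := zfStruct M; Sentence.Realize (M := {x : ZFSet // x ∈ M}) φ

/-- `(M, ∈) ⊨ φ[v₀, …, v_{k-1}]`: satisfaction of the formula `φ` in `M`, with the
(membership-checked) valuation `v` of its free variables. -/
def ZRealize (M : ZFSet) {k : ℕ} (φ : BF k) (v : Fin k → ZFSet) : Prop :=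
  ∀ h : ∀ i, v i ∈ M,
    letI := zfStruct M
    BoundedFormula.Realize (M := {x : ZFSet // x ∈ M}) φ (fun e => e.elim) (fun i => ⟨v i, h i⟩)

/-- `x` is a (von Neumann) ordinal: a transitive set of transitive sets. -/
def IsOrd (x : ZFSet) : Prop := x.IsTransitive ∧ ∀ y ∈ x, ZFSet.IsTransitive y


/-! ### Forcing: names, values, generic extensions -/

/-- The value `val(G, τ)` of a name `τ` under `G`, defined by `∈`-recursion:
`val(G, τ) = { val(G, σ) : ∃ p ∈ G, ⟨σ, p⟩ ∈ τ }`. -/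
noncomputable def zval (G : ZFSet) : ZFSet → ZFSet :=
  (InvImage.wf ZFSet.rank Ordinal.lt_wf).fix fun τ ih =>
    letI : ∀ (n : ℕ) (f : (Fin n → ZFSet) → ZFSet), ZFSet.Definable n f := fun _ _ => Classical.allZFSetDefinable _
    ZFSet.image (fun σ => if h : ZFSet.rank σ < ZFSet.rank τ then ih σ h else ∅)
      (ZFSet.sep (fun σ => ∃ p ∈ G, ZFSet.pair σ p ∈ τ) (ZFSet.sUnion (ZFSet.sUnion τ)))

/-- The generic extension `M[G] = { val(G, τ) : τ ∈ M }`. -/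
noncomputable def genExt (M G : ZFSet) : ZFSet :=
  letI : ∀ (n : ℕ) (f : (Fin n → ZFSet) → ZFSet), ZFSet.Definable n f := fun _ _ => Classical.allZFSetDefinable _
  ZFSet.image (zval G) M

/-- `⟨P, r, one⟩` is a forcing notion belonging to `M`: `r ∈ M` is (the graph of) a preorder
on `P ∈ M` with greatest element `one`. -/
def ForcingNotion (M P r one : ZFSet) : Prop :=
  P ∈ M ∧ r ∈ M ∧ one ∈ P ∧
    (∀ q ∈ r, ∃ a ∈ P, ∃ b ∈ P, q = ZFSet.pair a b) ∧
    (∀ p ∈ P, ZFSet.pair p p ∈ r) ∧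
    (∀ p ∈ P, ∀ q ∈ P, ∀ s ∈ P, ZFSet.pair p q ∈ r → ZFSet.pair q s ∈ r →
      ZFSet.pair p s ∈ r) ∧
    (∀ p ∈ P, ZFSet.pair p one ∈ r)

/-- `D` is a dense subset of the forcing notion `⟨P, r⟩`. -/
def IsDenseIn (r P D : ZFSet) : Prop :=
  D ⊆ P ∧ ∀ p ∈ P, ∃ d ∈ D, ZFSet.pair d p ∈ r

/-- `G` is a filter on `⟨P, r⟩`: upward closed and downward directed. -/
def IsFilterOn (r P G : ZFSet) : Prop :=
  G ⊆ P ∧ (∀ x ∈ G, ∀ y ∈ P, ZFSet.pair x y ∈ r → y ∈ G) ∧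
    (∀ x ∈ G, ∀ y ∈ G, ∃ z ∈ G, ZFSet.pair z x ∈ r ∧ ZFSet.pair z y ∈ r)

/-- `G` is an `M`-generic filter on `⟨P, r⟩`: a filter meeting every dense subset of `P`
that belongs to `M`. -/
def IsGeneric (M r P G : ZFSet) : Prop :=
  IsFilterOn r P G ∧ ∀ D ∈ M, IsDenseIn r P D → ∃ q ∈ G, q ∈ D


/-! ### Realization lemmas -/

/-- Elements of `N`. -/
abbrev El (N : ZFSet) := {x : ZFSet // x ∈ N}

attribute [local instance] zfStruct

section realize
variable {N : ZFSet} {n : ℕ} {α : Type*}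

theorem rz_mem {v : Empty → El N} {xs : Fin n → El N} {i j : Fin n} :
    (memf i j).Realize v xs ↔ (xs i).1 ∈ (xs j).1 := by
  unfold memf
  rw [BoundedFormula.realize_rel₂]
  rfl

theorem rz_eq {v : Empty → El N} {xs : Fin n → El N} {i j : Fin n} :
    (eqf i j).Realize v xs ↔ xs i = xs j := Iff.rfl

theorem rz_and {v : Empty → El N} {xs : Fin n → El N} {φ ψ : BF n} :
    (andF φ ψ).Realize v xs ↔ φ.Realize v xs ∧ ψ.Realize v xs := by
  unfold andF
  simp only [BoundedFormula.realize_not, BoundedFormula.realize_imp]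
  tauto

theorem rz_or {v : Empty → El N} {xs : Fin n → El N} {φ ψ : BF n} :
    (orF φ ψ).Realize v xs ↔ φ.Realize v xs ∨ ψ.Realize v xs := by
  unfold orF
  simp only [BoundedFormula.realize_not, BoundedFormula.realize_imp]
  tauto

theorem rz_iff {v : Empty → El N} {xs : Fin n → El N} {φ ψ : BF n} :
    (iffF φ ψ).Realize v xs ↔ (φ.Realize v xs ↔ ψ.Realize v xs) := by
  unfold iffF
  simp only [rz_and, BoundedFormula.realize_imp]
  tauto

theorem rz_relabel {m k : ℕ} (f : Fin m → Fin k) (φ : SetLang.BoundedFormula α m)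
    {v : α → El N} {xs : Fin k → El N} :
    (BoundedFormula.relabel (Sum.map id f) φ.toFormula :
      SetLang.BoundedFormula α (k + 0)).Realize v xs ↔ φ.Realize v (xs ∘ f) := by
  rw [BoundedFormula.realize_relabel]
  have := BoundedFormula.realize_toFormula φ (Sum.elim v (xs ∘ Fin.castAdd 0) ∘ Sum.map id f)
  rw [Formula.Realize] at this
  rw [Subsingleton.elim (xs ∘ Fin.natAdd k : Fin 0 → El N) default, this]
  rfl

theorem rz_reindex {m k : ℕ} (f : Fin m → Fin k) (φ : BF m)
    {v : Empty → El N} {xs : Fin k → El N} :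
    (reindex f φ).Realize v xs ↔ φ.Realize v (xs ∘ f) := rz_relabel f φ

/-- Transitive and closed under unordered pairs. -/
structure TP (N : ZFSet) : Prop where
  trans : N.IsTransitive
  pair : ∀ a ∈ N, ∀ b ∈ N, ({a, b} : ZFSet) ∈ N

theorem El.ext_iff' (h : N.IsTransitive) {a : El N} {s : ZFSet} (hs : s ⊆ N) :
    a.1 = s ↔ ∀ z : El N, z.1 ∈ a.1 ↔ z.1 ∈ s := by
  constructor
  · intro e z; rw [e]
  · intro e
    ext z
    exact ⟨fun hz => (e ⟨z, h.mem_trans hz a.2⟩).1 hz, fun hz => (e ⟨z, hs hz⟩).2 hz⟩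

variable {v : Empty → El N}

theorem rz_sub (h : N.IsTransitive) {xs : Fin 2 → El N} :
    subF.Realize v xs ↔ (xs 0).1 ⊆ (xs 1).1 := by
  unfold subF
  simp only [BoundedFormula.realize_all, BoundedFormula.realize_imp, rz_mem]
  exact ⟨fun H z hz => H ⟨z, h.mem_trans hz (xs 0).2⟩ hz, fun H a ha => H ha⟩

theorem rz_pairSet (h : TP N) {xs : Fin 3 → El N} :
    pairSetF.Realize v xs ↔ (xs 2).1 = {(xs 0).1, (xs 1).1} := by
  unfold pairSetF
  simp only [BoundedFormula.realize_all, rz_iff, rz_or, rz_mem, rz_eq]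
  rw [El.ext_iff' h.trans (h.trans _ (h.pair _ (xs 0).2 _ (xs 1).2))]
  simp only [ZFSet.mem_pair, ← Subtype.ext_iff]
  exact Iff.rfl

theorem rz_sing (h : TP N) {xs : Fin 2 → El N} :
    singF.Realize v xs ↔ (xs 1).1 = {(xs 0).1} := by
  unfold singF
  rw [rz_reindex, rz_pairSet h]
  have : ({(xs 0).1, (xs 0).1} : ZFSet) = {(xs 0).1} := by
    ext; simp
  rw [← this]
  rfl

theorem TP.sing (h : TP N) (a) (ha : a ∈ N) : ({a} : ZFSet) ∈ N := by
  have := h.pair a ha a ha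
  rwa [show ({a, a} : ZFSet) = {a} by ext; simp] at this

theorem TP.op (h : TP N) (a) (ha : a ∈ N) (b) (hb : b ∈ N) : ZFSet.pair a b ∈ N :=
  h.pair _ (h.sing a ha) _ (h.pair a ha b hb)

theorem rz_op (h : TP N) {xs : Fin 3 → El N} :
    opF.Realize v xs ↔ (xs 2).1 = ZFSet.pair (xs 0).1 (xs 1).1 := by
  unfold opF
  simp only [BoundedFormula.realize_all, rz_iff, rz_or, rz_mem, rz_reindex, rz_sing h,
    rz_pairSet h]
  rw [El.ext_iff' h.trans (h.trans _ (h.op _ (xs 0).2 _ (xs 1).2))]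
  simp only [ZFSet.pair, ZFSet.mem_pair]
  exact Iff.rfl

theorem rz_trans (h : N.IsTransitive) {xs : Fin 1 → El N} :
    transF.Realize v xs ↔ (xs 0).1.IsTransitive := by
  unfold transF
  simp only [BoundedFormula.realize_all, BoundedFormula.realize_imp, rz_mem, rz_reindex,
    rz_sub h]
  exact ⟨fun H z hz => H ⟨z, h.mem_trans hz (xs 0).2⟩ hz, fun H a ha => H a.1 ha⟩

theorem rz_ord (h : N.IsTransitive) {xs : Fin 1 → El N} :
    ordF.Realize v xs ↔ IsOrd (xs 0).1 := by
  unfold ordF IsOrd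
  simp only [rz_and, BoundedFormula.realize_all, BoundedFormula.realize_imp, rz_mem, rz_reindex,
    rz_trans h]
  refine and_congr Iff.rfl ?_
  exact ⟨fun H z hz => H ⟨z, h.mem_trans hz (xs 0).2⟩ hz, fun H a ha => H a.1 ha⟩

theorem rz_relMem (h : TP N) {xs : Fin 3 → El N} :
    relMemF.Realize v xs ↔ ZFSet.pair (xs 0).1 (xs 1).1 ∈ (xs 2).1 := by
  unfold relMemF
  simp only [rz_and, BoundedFormula.realize_ex, rz_mem, rz_reindex, rz_op h]
  constructor
  · rintro ⟨a, h1, h2⟩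
    change a.1 = ZFSet.pair (xs 0).1 (xs 1).1 at h1
    rw [← h1]
    exact h2
  · intro H
    exact ⟨⟨_, h.op _ (xs 0).2 _ (xs 1).2⟩, rfl, H⟩

/-- Semantic surjection. -/
def Surj (a b f : ZFSet) : Prop :=
  (∀ z ∈ f, ∃ x ∈ a, ∃ y ∈ b, z = ZFSet.pair x y) ∧
  (∀ x ∈ a, ∃ y ∈ b, ZFSet.pair x y ∈ f) ∧
  (∀ x y y', ZFSet.pair x y ∈ f → ZFSet.pair x y' ∈ f → y = y') ∧
  (∀ y ∈ b, ∃ x ∈ a, ZFSet.pair x y ∈ f)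

theorem pair_comp {N : ZFSet} (h : N.IsTransitive) {a b : ZFSet} (hab : ZFSet.pair a b ∈ N) :
    a ∈ N ∧ b ∈ N := by
  have h1 : ({a, b} : ZFSet) ∈ N := h.mem_trans (by simp [ZFSet.pair]) hab
  exact ⟨h.mem_trans (by simp) h1, h.mem_trans (by simp) h1⟩

theorem rz_func (h : TP N) {xs : Fin 3 → El N} :
    isFuncF.Realize v xs ↔ Surj (xs 0).1 (xs 1).1 (xs 2).1 := by
  unfold isFuncF Surj
  simp only [rz_and, BoundedFormula.realize_ex, BoundedFormula.realize_all,
    BoundedFormula.realize_imp, rz_mem, rz_eq, rz_reindex, rz_op h, rz_relMem h]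
  have T : ∀ {i : Fin 3} {z : ZFSet}, z ∈ (xs i).1 → z ∈ N := fun {i z} hz =>
    h.trans.mem_trans hz (xs i).2
  rw [and_assoc]
  refine and_congr ?_ (and_congr ?_ (and_congr ?_ ?_))
  · constructor
    · intro H z hz
      obtain ⟨x, y, ⟨hx, hy⟩, e⟩ := H ⟨z, T hz⟩ hz
      exact ⟨x, hx, y, hy, e⟩
    · intro H z hz
      obtain ⟨x, hx, y, hy, e⟩ := H z.1 hz
      exact ⟨⟨x, T hx⟩, ⟨y, T hy⟩, ⟨hx, hy⟩, e⟩
  · constructor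
    · intro H z hz
      obtain ⟨y, hy, e⟩ := H ⟨z, T hz⟩ hz
      exact ⟨y, hy, e⟩
    · intro H z hz
      obtain ⟨y, hy, e⟩ := H z.1 hz
      exact ⟨⟨y, T hy⟩, hy, e⟩
  · constructor
    · intro H x y y' h1 h2
      have := H ⟨x, (pair_comp h.trans (T h1)).1⟩ ⟨y, (pair_comp h.trans (T h1)).2⟩
        ⟨y', (pair_comp h.trans (T h2)).2⟩ ⟨h1, h2⟩
      exact Subtype.ext_iff.1 this
    · intro H x y y' hh
      exact Subtype.ext (H x.1 y.1 y'.1 hh.1 hh.2)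
  · constructor
    · intro H z hz
      obtain ⟨y, hy, e⟩ := H ⟨z, T hz⟩ hz
      exact ⟨y, hy, e⟩
    · intro H z hz
      obtain ⟨y, hy, e⟩ := H z.1 hz
      exact ⟨⟨y, T hy⟩, hy, e⟩

theorem rz_ac (h : TP N) :
    (Sentence.Realize (M := El N) acAx) ↔
      ∀ x ∈ N, ∃ a ∈ N, ∃ f ∈ N, IsOrd a ∧ Surj a x f := by
  unfold Sentence.Realize Formula.Realize acAx
  simp only [rz_and, BoundedFormula.realize_ex, BoundedFormula.realize_all, rz_reindex,
    rz_ord h.trans, rz_func h]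
  constructor
  · intro H x hx
    obtain ⟨a, f, h1, h2⟩ := H ⟨x, hx⟩
    exact ⟨a, a.2, f, f.2, h1, h2⟩
  · intro H x
    obtain ⟨a, ha, f, hf, h1, h2⟩ := H x.1 x.2
    exact ⟨⟨a, ha⟩, ⟨f, hf⟩, h1, h2⟩

end realize

/-! ### Definability with parameters -/

section dd
variable {N : ZFSet} {n : ℕ}

/-- Definable (with parameters) relation on `N`. -/
def Dd {N : ZFSet} {n : ℕ} (S : (Fin n → El N) → Prop) : Prop :=
  ∃ φ : SetLang.BoundedFormula (El N) n, ∀ v, φ.Realize id v ↔ S v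

theorem Dd.congr {S T : (Fin n → El N) → Prop} (h : Dd S) (e : ∀ v, T v ↔ S v) : Dd T := by
  obtain ⟨φ, hφ⟩ := h
  exact ⟨φ, fun v => (hφ v).trans (e v).symm⟩

theorem Dd.not {S : (Fin n → El N) → Prop} (h : Dd S) : Dd (fun v => ¬ S v) := by
  obtain ⟨φ, hφ⟩ := h
  exact ⟨φ.not, fun v => by rw [BoundedFormula.realize_not, hφ]⟩

theorem Dd.imp {S T : (Fin n → El N) → Prop} (h : Dd S) (h' : Dd T) :
    Dd (fun v => S v → T v) := by
  obtain ⟨φ, hφ⟩ := h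
  obtain ⟨ψ, hψ⟩ := h'
  exact ⟨φ.imp ψ, fun v => by rw [BoundedFormula.realize_imp, hφ, hψ]⟩

theorem Dd.and {S T : (Fin n → El N) → Prop} (h : Dd S) (h' : Dd T) :
    Dd (fun v => S v ∧ T v) :=
  (h.imp h'.not).not.congr fun v => by tauto

theorem Dd.or {S T : (Fin n → El N) → Prop} (h : Dd S) (h' : Dd T) :
    Dd (fun v => S v ∨ T v) :=
  (h.not.imp h').congr fun v => by tauto

theorem Dd.iff {S T : (Fin n → El N) → Prop} (h : Dd S) (h' : Dd T) :
    Dd (fun v => S v ↔ T v) :=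
  ((h.imp h').and (h'.imp h)).congr fun v => by tauto

theorem Dd.all {S : (Fin n → El N) → El N → Prop}
    (h : Dd (fun w : Fin (n + 1) → El N => S (Fin.init w) (w (Fin.last n)))) :
    Dd (fun v => ∀ x, S v x) := by
  obtain ⟨φ, hφ⟩ := h
  refine ⟨φ.all, fun v => ?_⟩
  simp only [BoundedFormula.realize_all, hφ, Fin.init_snoc, Fin.snoc_last]

theorem Dd.ex {S : (Fin n → El N) → El N → Prop}
    (h : Dd (fun w : Fin (n + 1) → El N => S (Fin.init w) (w (Fin.last n)))) :
    Dd (fun v => ∃ x, S v x) := by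
  obtain ⟨φ, hφ⟩ := h
  refine ⟨φ.ex, fun v => ?_⟩
  simp only [BoundedFormula.realize_ex, hφ, Fin.init_snoc, Fin.snoc_last]

theorem Dd.comp {m : ℕ} {S : (Fin m → El N) → Prop} (h : Dd S) (f : Fin m → Fin n) :
    Dd (fun v : Fin n → El N => S (v ∘ f)) := by
  obtain ⟨φ, hφ⟩ := h
  exact ⟨_, fun v => (rz_relabel f φ).trans (hφ _)⟩

theorem Dd.mem0 (i j : Fin n) : Dd (fun v : Fin n → El N => (v i).1 ∈ (v j).1) :=
  ⟨memSymb.boundedFormula₂ (Term.var (Sum.inr i)) (Term.var (Sum.inr j)), fun v => by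
    rw [BoundedFormula.realize_rel₂]; rfl⟩

theorem Dd.eq0 (i j : Fin n) : Dd (fun v : Fin n → El N => v i = v j) :=
  ⟨Term.bdEqual (Term.var (Sum.inr i)) (Term.var (Sum.inr j)), fun _ => Iff.rfl⟩

/-- Definable function. -/
def Tm {N : ZFSet} {n : ℕ} (F : (Fin n → El N) → El N) : Prop :=
  Dd (fun w : Fin (n + 1) → El N => w (Fin.last n) = F (Fin.init w))

theorem Tm.const (c : El N) : Tm (fun _ : Fin n → El N => c) :=
  ⟨Term.bdEqual (Term.var (Sum.inr (Fin.last n))) (Term.var (Sum.inl c)), fun _ => Iff.rfl⟩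

theorem Tm.proj {F : (Fin n → El N) → El N} (h : ∃ i, ∀ v, F v = v i) : Tm F := by
  obtain ⟨i, hi⟩ := h
  refine (Dd.eq0 (Fin.last n) i.castSucc).congr fun v => ?_
  rw [hi]
  rfl

theorem Tm.weak {F : (Fin n → El N) → El N} (h : Tm F) :
    Tm (fun w : Fin (n + 1) → El N => F (Fin.init w)) := by
  refine (Dd.comp h (Fin.snoc (fun i : Fin n => i.castSucc.castSucc) (Fin.last _)
    : Fin (n + 1) → Fin (n + 1 + 1))).congr fun v => ?_
  have h1 : (Fin.init (v ∘ (Fin.snoc (fun i : Fin n => i.castSucc.castSucc) (Fin.last _)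
    : Fin (n + 1) → Fin (n + 1 + 1)))) = Fin.init (Fin.init v) := by
    funext i
    simp [Fin.init]
  rw [h1]
  simp

theorem Dd.bind {t : (Fin n → El N) → El N} {S : (Fin n → El N) → El N → Prop} (ht : Tm t)
    (h : Dd (fun w : Fin (n + 1) → El N => S (Fin.init w) (w (Fin.last n)))) :
    Dd (fun v => S v (t v)) := by
  refine (Dd.ex (S := fun v x => x = t v ∧ S v x) (Dd.and ht h)).congr fun v => ?_
  simp

theorem Dd.mem {t u : (Fin n → El N) → El N} (ht : Tm t) (hu : Tm u) :
    Dd (fun v => (t v).1 ∈ (u v).1) :=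
  Dd.bind (S := fun v x => x.1 ∈ (u v).1) ht
    (Dd.bind (S := fun w y => (w (Fin.last n)).1 ∈ y.1) hu.weak
      (Dd.mem0 (Fin.last n).castSucc (Fin.last _)))

theorem Dd.eq {t u : (Fin n → El N) → El N} (ht : Tm t) (hu : Tm u) :
    Dd (fun v => t v = u v) :=
  Dd.bind (S := fun v x => x = u v) ht
    (Dd.bind (S := fun w y => w (Fin.last n) = y) hu.weak
      (Dd.eq0 (Fin.last n).castSucc (Fin.last _)))

/-- unordered pair in `N`. -/
def up (h : TP N) (a b : El N) : El N := ⟨{a.1, b.1}, h.pair _ a.2 _ b.2⟩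

/-- ordered pair in `N`. -/
def op (h : TP N) (a b : El N) : El N := ⟨ZFSet.pair a.1 b.1, h.op _ a.2 _ b.2⟩

theorem op_eq (h : TP N) (a b : El N) : op h a b = up h (up h a a) (up h a b) := by
  apply Subtype.ext
  simp only [op, up, ZFSet.pair]
  rw [show ({a.1, a.1} : ZFSet) = {a.1} by ext; simp]

theorem Tm.up (h : TP N) {t u : (Fin n → El N) → El N} (ht : Tm t) (hu : Tm u) :
    Tm (fun v => up h (t v) (u v)) := by
  refine Dd.congr (S := fun w : Fin (n + 1) → El N => ∀ z : El N, z.1 ∈ (w (Fin.last n)).1 ↔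
    (z = t (Fin.init w) ∨ z = u (Fin.init w))) ?_ ?_
  · refine Dd.all (Dd.iff (Dd.mem (Tm.proj ⟨_, fun _ => rfl⟩) (Tm.proj ⟨_, fun _ => rfl⟩)) ?_)
    refine Dd.or (Dd.eq (Tm.proj ⟨_, fun _ => rfl⟩) ht.weak.weak)
      (Dd.eq (Tm.proj ⟨_, fun _ => rfl⟩) hu.weak.weak)
  · intro w
    rw [Subtype.ext_iff, El.ext_iff' h.trans (h.trans _ (CtmForcing.up h _ _).2)]
    simp only [CtmForcing.up, ZFSet.mem_pair, ← Subtype.ext_iff]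

theorem Tm.op (h : TP N) {t u : (Fin n → El N) → El N} (ht : Tm t) (hu : Tm u) :
    Tm (fun v => op h (t v) (u v)) := by
  simp only [op_eq]
  exact Tm.up h (Tm.up h ht ht) (Tm.up h ht hu)

theorem Dd.toBF {n : ℕ} {S : (Fin n → El N) → Prop} (h : Dd S) :
    ∃ (k : ℕ) (p : Fin k → El N) (ψ : BF (k + n)), ∀ (v : Empty → El N) (xs : Fin (k + n) → El N),
      (∀ i, xs (Fin.castAdd n i) = p i) → (ψ.Realize v xs ↔ S (xs ∘ Fin.natAdd k)) := by
  classical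
  obtain ⟨φ, hφ⟩ := h
  let e := φ.freeVarFinset.equivFin
  refine ⟨_, fun i => (e.symm i).1,
    BoundedFormula.relabel (Sum.inr : _ → Empty ⊕ Fin _) (φ.restrictFreeVar e), ?_⟩
  intro v xs hxs
  rw [BoundedFormula.realize_relabel, ← hφ]
  apply BoundedFormula.realize_restrictFreeVar
  intro a
  simp [hxs]

end dd

/-! ### The axioms, semantically -/

/-- Semantic content of the axioms used. -/
structure Mod (N : ZFSet) : Prop extends TP N where
  union : ∀ a : El N, ∃ b : El N, ∀ x : El N, x.1 ∈ b.1 ↔ ∃ y : El N, y.1 ∈ a.1 ∧ x.1 ∈ y.1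
  sep : ∀ S : El N → Prop, Dd (fun v : Fin 1 → El N => S (v 0)) → ∀ A : El N,
    ∃ B : El N, ∀ x : El N, x.1 ∈ B.1 ↔ x.1 ∈ A.1 ∧ S x
  rep : ∀ S : El N → El N → Prop, Dd (fun v : Fin 2 → El N => S (v 0) (v 1)) → ∀ A : El N,
    (∀ x : El N, x.1 ∈ A.1 → ∀ y y', S x y → S x y' → y = y') →
    ∃ B : El N, ∀ y : El N, y.1 ∈ B.1 ↔ ∃ x : El N, x.1 ∈ A.1 ∧ S x y

theorem tp_of_models {M : ZFSet} (htrans : M.IsTransitive) (h : ZModels M ZF) : TP M := by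
  refine ⟨htrans, ?_⟩
  intro a ha b hb
  have := h pairAx (by simp [ZF, Z, zfFin])
  unfold Sentence.Realize Formula.Realize pairAx pairSetF at this
  simp only [BoundedFormula.realize_ex, BoundedFormula.realize_all, rz_iff, rz_or, rz_mem,
    rz_eq] at this
  obtain ⟨c, hc⟩ := this ⟨a, ha⟩ ⟨b, hb⟩
  have : c.1 = {a, b} := by
    ext z
    rw [ZFSet.mem_pair]
    constructor
    · intro hz
      rcases (hc ⟨z, htrans.mem_trans hz c.2⟩).1 hz with e | e
      · exact Or.inl (Subtype.ext_iff.1 e)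
      · exact Or.inr (Subtype.ext_iff.1 e)
    · rintro (rfl | rfl)
      · exact (hc ⟨z, ha⟩).2 (Or.inl rfl)
      · exact (hc ⟨z, hb⟩).2 (Or.inr rfl)
  rw [← this]
  exact c.2

theorem mod_of_models {M : ZFSet} (htrans : M.IsTransitive) (h : ZModels M ZF) : Mod M := by
  refine ⟨tp_of_models htrans h, ?_, ?_, ?_⟩
  · intro a
    have := h unionAx (by simp [ZF, Z, zfFin])
    unfold Sentence.Realize Formula.Realize unionAx at this
    simp only [BoundedFormula.realize_ex, BoundedFormula.realize_all, rz_iff, rz_and,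
      rz_mem] at this
    exact this a
  · intro S hS A
    obtain ⟨k, p, ψ, hψ⟩ := hS.toBF
    have := h (sepAx ψ) (Or.inl (Or.inr ⟨⟨k, ψ⟩, rfl⟩))
    unfold Sentence.Realize sepAx at this
    rw [BoundedFormula.realize_alls] at this
    have := this p
    simp only [BoundedFormula.realize_ex, BoundedFormula.realize_all, rz_iff, rz_and,
      rz_mem, rz_reindex] at this
    obtain ⟨B, hB⟩ := this A
    refine ⟨B, fun x => ?_⟩
    have := hB x
    rw [hψ] at this
    · simpa [Fin.snoc] using this
    · intro i
      have := i.2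
      simp [Fin.snoc]
      omega
  · intro S hS A hfun
    obtain ⟨k, p, ψ, hψ⟩ := hS.toBF
    have := h (replAx ψ) (Or.inr ⟨⟨k, ψ⟩, rfl⟩)
    unfold Sentence.Realize replAx at this
    rw [BoundedFormula.realize_alls] at this
    have := this p
    simp only [BoundedFormula.realize_ex, BoundedFormula.realize_all, rz_iff, rz_and,
      BoundedFormula.realize_imp, rz_mem, rz_reindex, rz_eq] at this
    obtain ⟨B, hB⟩ := this A (by
      intro x y y' hh
      rw [hψ, hψ] at hh
      · have : x.1 ∈ A.1 ∧ S x y ∧ S x y' := by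
          simpa [Fin.snoc] using hh
        have := hfun x this.1 y y' this.2.1 this.2.2
        simpa [Fin.snoc] using this
      all_goals
        intro i
        have h1 := i.2
        have h2 : (i : ℕ) < k + 1 := by omega
        have h3 : (i : ℕ) < k + 2 := by omega
        have h4 : (i : ℕ) < k + 3 := by omega
        simp [Fin.snoc, h2, h3, h4])
    refine ⟨B, fun y => ?_⟩
    have := hB y
    have e1 : ((Fin.snoc (Fin.snoc (Fin.snoc p A) B) y : Fin (k + 3) → El M) ⟨k + 2, by omega⟩) = y :=
      by simp [Fin.snoc]
    have e2 : ((Fin.snoc (Fin.snoc (Fin.snoc p A) B) y : Fin (k + 3) → El M) ⟨k + 1, by omega⟩) = B :=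
      by simp [Fin.snoc]
    rw [e1, e2] at this
    rw [this]
    refine exists_congr fun x => ?_
    rw [hψ]
    · simp [Fin.snoc]
    · intro i
      have h1 := i.2
      have h2 : (i : ℕ) < k + 1 := by omega
      have h3 : (i : ℕ) < k + 2 := by omega
      have h4 : (i : ℕ) < k + 3 := by omega
      simp [Fin.snoc, h2, h3, h4]

section names
variable {M : ZFSet}

theorem Mod.rep2 (hM : Mod M) (S : El M → El M → El M → Prop)
    (hS : Dd (fun v : Fin 3 → El M => S (v 0) (v 1) (v 2))) (A B : El M)
    (hf : ∀ x y : El M, x.1 ∈ A.1 → y.1 ∈ B.1 → ∀ z z', S x y z → S x y z' → z = z') :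
    ∃ C : El M, ∀ z : El M, z.1 ∈ C.1 ↔
      ∃ x y : El M, x.1 ∈ A.1 ∧ y.1 ∈ B.1 ∧ S x y z := by
  let T : El M → El M → Prop := fun x c =>
    ∀ z : El M, z.1 ∈ c.1 ↔ ∃ y : El M, y.1 ∈ B.1 ∧ S x y z
  have hT : Dd (fun v : Fin 2 → El M => T (v 0) (v 1)) := by
    refine Dd.all (Dd.iff (Dd.mem (Tm.proj ⟨_, fun _ => rfl⟩) (Tm.proj ⟨_, fun _ => rfl⟩))
      (Dd.ex (Dd.and (Dd.mem (Tm.proj ⟨_, fun _ => rfl⟩) (Tm.const B)) ?_)))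
    exact hS.comp ![0, 3, 2]
  obtain ⟨D, hD⟩ := hM.rep T hT A (by
    intro x hx c c' h1 h2
    rw [Subtype.ext_iff, El.ext_iff' hM.trans (hM.trans _ c'.2)]
    intro z
    rw [h1, h2])
  obtain ⟨C, hC⟩ := hM.union D
  refine ⟨C, fun z => ?_⟩
  rw [hC]
  constructor
  · rintro ⟨c, hc, hz⟩
    obtain ⟨x, hx, hxc⟩ := (hD c).1 hc
    obtain ⟨y, hy, h⟩ := (hxc z).1 hz
    exact ⟨x, y, hx, hy, h⟩
  · rintro ⟨x, y, hx, hy, h⟩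
    obtain ⟨c, hc⟩ := hM.rep (S x)
      (Dd.bind (S := fun v x => S x (v 0) (v 1)) (Tm.const x) (hS.comp ![2, 0, 1])) B
      (fun y hy z z' => hf x y hx hy z z')
    exact ⟨c, (hD c).2 ⟨x, hx, hc⟩, (hc z).2 ⟨y, hy, h⟩⟩

/-- Recursion step for check names. -/
def KK (h : TP M) (o f a b : El M) : Prop :=
  (∀ a' : El M, a'.1 ∈ a.1 → ∃ b' : El M, (op h a' b').1 ∈ f.1) ∧
  (∀ c : El M, c.1 ∈ b.1 ↔ ∃ a' : El M, a'.1 ∈ a.1 ∧ ∃ b' : El M,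
    (op h a' b').1 ∈ f.1 ∧ c = op h b' o)

/-- `z` is the check name of `y`, as computed in `M`. -/
def RR (h : TP M) (o y z : El M) : Prop :=
  ∃ f : El M, (∀ a b : El M, (op h a b).1 ∈ f.1 → KK h o f a b) ∧ KK h o f y z

theorem dd_RR (h : TP M) (o : El M) : Dd (fun v : Fin 2 → El M => RR h o (v 0) (v 1)) := by
  unfold RR KK
  repeat' first
    | with_reducible refine Dd.ex ?_
    | with_reducible refine Dd.all ?_
    | with_reducible refine Dd.and ?_ ?_
    | with_reducible refine Dd.iff ?_ ?_
    | with_reducible refine Dd.imp ?_ ?_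
    | with_reducible refine Dd.mem ?_ ?_
    | with_reducible refine Dd.eq ?_ ?_
    | with_reducible refine Tm.op h ?_ ?_
    | with_reducible exact Tm.const _
    | exact Tm.proj ⟨_, fun _ => rfl⟩

theorem KK_unique (h : TP M) (o : El M) {f f' : El M}
    (hf : ∀ a b : El M, (op h a b).1 ∈ f.1 → KK h o f a b)
    (hf' : ∀ a b : El M, (op h a b).1 ∈ f'.1 → KK h o f' a b) :
    ∀ (x : ZFSet) (a : El M), a.1 = x → ∀ b b', KK h o f a b → KK h o f' a b' → b = b' := by
  intro x
  induction x using ZFSet.inductionOn with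
  | h x ih =>
    rintro a rfl b b' hb hb'
    rw [Subtype.ext_iff, El.ext_iff' h.trans (h.trans _ b'.2)]
    intro c
    rw [hb.2, hb'.2]
    constructor
    · rintro ⟨a', ha', b1, h1, rfl⟩
      obtain ⟨b2, h2⟩ := hb'.1 a' ha'
      have := ih a'.1 ha' a' rfl b1 b2 (hf _ _ h1) (hf' _ _ h2)
      subst this
      exact ⟨a', ha', _, h2, rfl⟩
    · rintro ⟨a', ha', b1, h1, rfl⟩
      obtain ⟨b2, h2⟩ := hb.1 a' ha'
      have := ih a'.1 ha' a' rfl b2 b1 (hf _ _ h2) (hf' _ _ h1)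
      subst this
      exact ⟨a', ha', _, h2, rfl⟩

theorem RR_unique (h : TP M) (o : El M) {y z z' : El M} (h1 : RR h o y z) (h2 : RR h o y z') :
    z = z' := by
  obtain ⟨f, hf, k⟩ := h1
  obtain ⟨f', hf', k'⟩ := h2
  exact KK_unique h o hf hf' _ y rfl z z' k k'

theorem RR_exists (hM : Mod M) (o : El M) :
    ∀ (x : ZFSet) (y : El M), y.1 = x → IsOrd x → ∃ z, RR hM.toTP o y z := by
  intro x
  induction x using ZFSet.inductionOn with
  | h x ih =>
    rintro y rfl hy
    have hR := dd_RR hM.toTP o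
    have ih' : ∀ a : El M, a.1 ∈ y.1 → ∃ z, RR hM.toTP o a z := by
      intro a ha
      exact ih a.1 ha a rfl ⟨hy.2 _ ha, fun c hc => hy.2 _ (hy.1.mem_trans hc ha)⟩
    obtain ⟨F, hF⟩ := hM.rep (fun a p => ∃ b, RR hM.toTP o a b ∧ p = op hM.toTP a b)
      (by
        refine Dd.ex (Dd.and ?_ (Dd.eq (Tm.proj ⟨_, fun _ => rfl⟩)
          (Tm.op _ (Tm.proj ⟨_, fun _ => rfl⟩) (Tm.proj ⟨_, fun _ => rfl⟩))))
        exact hR.comp ![0, 2]) y (by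
        rintro a ha p p' ⟨b, hb, rfl⟩ ⟨b', hb', rfl⟩
        rw [RR_unique _ _ hb hb'])
    obtain ⟨Z, hZ⟩ := hM.rep (fun a p => ∃ b, RR hM.toTP o a b ∧ p = op hM.toTP b o)
      (by
        refine Dd.ex (Dd.and ?_ (Dd.eq (Tm.proj ⟨_, fun _ => rfl⟩)
          (Tm.op _ (Tm.proj ⟨_, fun _ => rfl⟩) (Tm.const o))))
        exact hR.comp ![0, 2]) y (by
        rintro a ha p p' ⟨b, hb, rfl⟩ ⟨b', hb', rfl⟩
        rw [RR_unique _ _ hb hb'])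
    have hF' : ∀ a b : El M, (op hM.toTP a b).1 ∈ F.1 ↔ a.1 ∈ y.1 ∧ RR hM.toTP o a b := by
      intro a b
      rw [hF]
      constructor
      · rintro ⟨a', ha', b', hb', e⟩
        have := ZFSet.pair_inj.1 (Subtype.ext_iff.1 e)
        have e1 : a = a' := Subtype.ext this.1
        have e2 : b = b' := Subtype.ext this.2
        subst e1 e2
        exact ⟨ha', hb'⟩
      · rintro ⟨h1, h2⟩
        exact ⟨a, h1, b, h2, rfl⟩
    refine ⟨Z, F, ?_, ?_⟩
    · intro a b hab
      rw [hF'] at hab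
      obtain ⟨ha, f, hf, hk⟩ := hab
      have sub : ∀ a' : El M, a'.1 ∈ a.1 → a'.1 ∈ y.1 := fun a' h' => hy.1.mem_trans h' ha
      refine ⟨fun a' ha' => ?_, fun c => ?_⟩
      · obtain ⟨z, hz⟩ := ih' a' (sub a' ha')
        exact ⟨z, (hF' _ _).2 ⟨sub a' ha', hz⟩⟩
      · rw [hk.2]
        constructor
        · rintro ⟨a', ha', b', hb', e⟩
          exact ⟨a', ha', b', (hF' _ _).2 ⟨sub a' ha', f, hf, hf _ _ hb'⟩, e⟩
        · rintro ⟨a', ha', b', hb', e⟩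
          obtain ⟨b2, h2⟩ := hk.1 a' ha'
          have := RR_unique hM.toTP o ((hF' _ _).1 hb').2 ⟨f, hf, hf _ _ h2⟩
          subst this
          exact ⟨a', ha', _, h2, e⟩
    · refine ⟨fun a' ha' => ?_, fun c => ?_⟩
      · obtain ⟨z, hz⟩ := ih' a' ha'
        exact ⟨z, (hF' _ _).2 ⟨ha', hz⟩⟩
      · rw [hZ]
        constructor
        · rintro ⟨a', ha', b', hb', e⟩
          exact ⟨a', ha', b', (hF' _ _).2 ⟨ha', hb'⟩, e⟩
        · rintro ⟨a', ha', b', hb', e⟩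
          exact ⟨a', ha', b', ((hF' _ _).1 hb').2, e⟩

theorem mem_zval {G τ x : ZFSet} :
    x ∈ zval G τ ↔ ∃ σ, ∃ p ∈ G, ZFSet.pair σ p ∈ τ ∧ x = zval G σ := by
  have hr : ∀ σ p : ZFSet, ZFSet.pair σ p ∈ τ → σ.rank < τ.rank := by
    intro σ p h
    have h1 : ({σ} : ZFSet) ∈ ZFSet.pair σ p := by simp [ZFSet.pair]
    have h2 : σ ∈ ({σ} : ZFSet) := by simp
    exact (ZFSet.rank_lt_of_mem h2).trans ((ZFSet.rank_lt_of_mem h1).trans (ZFSet.rank_lt_of_mem h))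
  rw [zval, WellFounded.fix_eq]
  simp only [ZFSet.mem_image, ZFSet.mem_sep]
  constructor
  · rintro ⟨σ, ⟨-, p, hp, h⟩, rfl⟩
    refine ⟨σ, p, hp, h, ?_⟩
    rw [dif_pos (hr _ _ h)]
  · rintro ⟨σ, p, hp, h, rfl⟩
    refine ⟨σ, ⟨?_, p, hp, h⟩, ?_⟩
    · rw [ZFSet.mem_sUnion]
      refine ⟨{σ}, ?_, by simp⟩
      rw [ZFSet.mem_sUnion]
      exact ⟨_, h, by simp [ZFSet.pair]⟩
    · rw [dif_pos (hr _ _ h)]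

theorem mem_genExt {G x : ZFSet} : x ∈ genExt M G ↔ ∃ τ ∈ M, zval G τ = x := by
  simp only [genExt, ZFSet.mem_image]

theorem KK_val (h : TP M) (o : El M) {G : ZFSet} (ho : o.1 ∈ G) {f : El M}
    (hf : ∀ a b : El M, (op h a b).1 ∈ f.1 → KK h o f a b) :
    ∀ (x : ZFSet) (a : El M), a.1 = x → ∀ b, KK h o f a b → zval G b.1 = a.1 := by
  intro x
  induction x using ZFSet.inductionOn with
  | h x ih =>
    rintro a rfl b hb
    ext c
    rw [mem_zval]
    constructor
    · rintro ⟨σ, p, hp, hm, rfl⟩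
      have hc := h.trans.mem_trans hm b.2
      obtain ⟨a', ha', b', hb', e⟩ := (hb.2 ⟨_, hc⟩).1 hm
      have e1 := (ZFSet.pair_inj.1 (Subtype.ext_iff.1 e)).1
      rw [e1, ih a'.1 ha' a' rfl b' (hf _ _ hb')]
      exact ha'
    · intro hc
      obtain ⟨b', hb'⟩ := hb.1 ⟨c, h.trans.mem_trans hc a.2⟩ hc
      refine ⟨b'.1, o.1, ho, ?_, ?_⟩
      · exact (hb.2 (op h b' o)).2 ⟨_, hc, b', hb', rfl⟩
      · exact (ih c hc ⟨c, h.trans.mem_trans hc a.2⟩ rfl b' (hf _ _ hb')).symm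

theorem RR_val (h : TP M) (o : El M) {G : ZFSet} (ho : o.1 ∈ G) {y z : El M}
    (hR : RR h o y z) : zval G z.1 = y.1 := by
  obtain ⟨f, hf, hk⟩ := hR
  exact KK_val h o ho hf _ y rfl z hk

/-- name for an unordered pair -/
def upN (h : TP M) (o a b : El M) : El M := up h (op h a o) (op h b o)

/-- name for an ordered pair -/
def opN (h : TP M) (o a b : El M) : El M := upN h o (upN h o a a) (upN h o a b)

theorem zval_upN (h : TP M) (o a b : El M) {G : ZFSet} (ho : o.1 ∈ G) :
    zval G (upN h o a b).1 = {zval G a.1, zval G b.1} := by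
  ext x
  rw [mem_zval, ZFSet.mem_pair]
  simp only [upN, up, op, ZFSet.mem_pair]
  constructor
  · rintro ⟨σ, p, hp, h | h, rfl⟩
    · rw [(ZFSet.pair_inj.1 h).1]; exact Or.inl rfl
    · rw [(ZFSet.pair_inj.1 h).1]; exact Or.inr rfl
  · rintro (rfl | rfl)
    · exact ⟨_, _, ho, Or.inl rfl, rfl⟩
    · exact ⟨_, _, ho, Or.inr rfl, rfl⟩

theorem zval_opN (h : TP M) (o a b : El M) {G : ZFSet} (ho : o.1 ∈ G) :
    zval G (opN h o a b).1 = ZFSet.pair (zval G a.1) (zval G b.1) := by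
  rw [opN, zval_upN h _ _ _ ho, zval_upN h _ _ _ ho, zval_upN h _ _ _ ho, ZFSet.pair]
  congr 1
  ext; simp

theorem Tm.opN {n : ℕ} (h : TP M) (o : El M) {t u : (Fin n → El M) → El M}
    (ht : Tm t) (hu : Tm u) : Tm (fun v => opN h o (t v) (u v)) := by
  have hup : ∀ {t u : (Fin n → El M) → El M}, Tm t → Tm u → Tm (fun v => upN h o (t v) (u v)) :=
    fun ht hu => Tm.up h (Tm.op h ht (Tm.const o)) (Tm.op h hu (Tm.const o))
  exact hup (hup ht ht) (hup ht hu)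

theorem tp_genExt (h : TP M) (o : El M) {G : ZFSet} (ho : o.1 ∈ G) : TP (genExt M G) := by
  constructor
  · intro y hy z hz
    obtain ⟨τ, hτ, rfl⟩ := mem_genExt.1 hy
    obtain ⟨σ, p, hp, hm, rfl⟩ := mem_zval.1 hz
    exact mem_genExt.2 ⟨σ, (pair_comp h.trans (h.trans.mem_trans hm hτ)).1, rfl⟩
  · intro a ha b hb
    obtain ⟨τ, hτ, rfl⟩ := mem_genExt.1 ha
    obtain ⟨σ, hσ, rfl⟩ := mem_genExt.1 hb
    exact mem_genExt.2 ⟨_, (upN h o ⟨τ, hτ⟩ ⟨σ, hσ⟩).2, zval_upN h o _ _ ho⟩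

end names

theorem generic_incompat {M P r one G : ZFSet} (hM : Mod M) (hfo : ForcingNotion M P r one)
    (hG : IsGeneric M r P G) {p : ZFSet} (hp : p ∈ P) (hpG : p ∉ G) :
    ∃ q ∈ G, ¬ ∃ t ∈ P, ZFSet.pair t q ∈ r ∧ ZFSet.pair t p ∈ r := by
  obtain ⟨hP, hr, hone, hrel, hrefl, htr, hmax⟩ := hfo
  have hPM : ∀ {x}, x ∈ P → x ∈ M := fun hx => hM.trans.mem_trans hx hP
  let h := hM.toTP
  let P' : El M := ⟨P, hP⟩
  let r' : El M := ⟨r, hr⟩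
  let p' : El M := ⟨p, hPM hp⟩
  obtain ⟨D, hD⟩ := hM.sep (fun q => (op h q p').1 ∈ r'.1 ∨
      ¬ ∃ t : El M, t.1 ∈ P'.1 ∧ (op h t q).1 ∈ r'.1 ∧ (op h t p').1 ∈ r'.1)
    (by
      repeat' first
        | with_reducible refine Dd.ex ?_
        | with_reducible refine Dd.or ?_ ?_
        | with_reducible refine Dd.not ?_
        | with_reducible refine Dd.and ?_ ?_
        | with_reducible refine Dd.mem ?_ ?_
        | with_reducible refine Tm.op h ?_ ?_
        | with_reducible exact Tm.const _
        | exact Tm.proj ⟨_, fun _ => rfl⟩) P'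
  have hDP : ∀ x ∈ D.1, x ∈ P := fun x hx =>
    ((hD ⟨x, hM.trans.mem_trans hx D.2⟩).1 hx).1
  obtain ⟨q, hqG, hqD⟩ := hG.2 D.1 D.2 ⟨fun x hx => hDP x hx, by
    intro s hs
    by_cases hc : ∃ t ∈ P, ZFSet.pair t s ∈ r ∧ ZFSet.pair t p ∈ r
    · obtain ⟨t, ht, h1, h2⟩ := hc
      exact ⟨t, (hD ⟨t, hPM ht⟩).2 ⟨ht, Or.inl h2⟩, h1⟩
    · refine ⟨s, (hD ⟨s, hPM hs⟩).2 ⟨hs, Or.inr ?_⟩, hrefl s hs⟩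
      rintro ⟨t, h1, h2, h3⟩
      exact hc ⟨t.1, h1, h2, h3⟩⟩
  refine ⟨q, hqG, ?_⟩
  have hqP := hDP q hqD
  rcases ((hD ⟨q, hPM hqP⟩).1 hqD).2 with h1 | h1
  · exact absurd (hG.1.2.1 q hqG p hp h1) hpG
  · rintro ⟨t, ht, h2, h3⟩
    exact h1 ⟨⟨t, hPM ht⟩, ht, h2, h3⟩

theorem main_aux {M P r one G : ZFSet} (hM : Mod M) (hfo : ForcingNotion M P r one)
    (hG : IsGeneric M r P G)
    (hac : ∀ x ∈ M, ∃ a ∈ M, ∃ f ∈ M, IsOrd a ∧ Surj a x f) (hone : one ∈ G) :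
    ∀ x ∈ genExt M G, ∃ a ∈ genExt M G, ∃ f ∈ genExt M G, IsOrd a ∧ Surj a x f := by
  intro X hX
  by_cases hne : ∃ x0, x0 ∈ X
  swap
  · push Not at hne
    refine ⟨X, hX, X, hX, ⟨fun y hy => absurd hy (hne y), fun y hy => absurd hy (hne y)⟩,
      fun y hy => absurd hy (hne y), fun y hy => absurd hy (hne y),
      fun x y y' hy => absurd hy (hne _), fun y hy => absurd hy (hne y)⟩
  obtain ⟨x0, hx0⟩ := hne
  have hincompat := fun {p : ZFSet} (hp : p ∈ P) (hpG : p ∉ G) =>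
    generic_incompat hM hfo hG hp hpG
  obtain ⟨hP, hr, honeP, hrel, hrefl, htr, hmax⟩ := hfo
  obtain ⟨⟨hGP, hGup, hGdir⟩, -⟩ := hG
  obtain ⟨τ, hτ, rfl⟩ := mem_genExt.1 hX
  obtain ⟨σ0, p0, hp0, hm0, e0⟩ := mem_zval.1 hx0
  have h : TP M := hM.toTP
  have hPM : ∀ {x}, x ∈ P → x ∈ M := fun hx => hM.trans.mem_trans hx hP
  have hτM : ∀ {a b}, ZFSet.pair a b ∈ τ → a ∈ M ∧ b ∈ M := fun hx =>
    pair_comp hM.trans (hM.trans.mem_trans hx hτ)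
  obtain ⟨α, hα, f, hf, hord, hf1, hf2, hf3, hf4⟩ := hac τ hτ
  let P' : El M := ⟨P, hP⟩
  let r' : El M := ⟨r, hr⟩
  let f' : El M := ⟨f, hf⟩
  let α' : El M := ⟨α, hα⟩
  let s0 : El M := ⟨σ0, (hτM hm0).1⟩
  let o : El M := ⟨one, hPM honeP⟩
  have ho : o.1 ∈ G := hone
  let C : El M → El M → El M → Prop := fun β q s =>
    (op h β (op h s q)).1 ∈ f'.1 ∨ (s = s0 ∧ ¬ ∃ σ p : El M, (op h β (op h σ p)).1 ∈ f'.1 ∧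
      p.1 ∈ P'.1 ∧ ∃ t : El M, t.1 ∈ P'.1 ∧ (op h t q).1 ∈ r'.1 ∧ (op h t p).1 ∈ r'.1)
  let S : El M → El M → El M → Prop := fun β q z => ∃ b s : El M,
    z = op h (opN h o b s) q ∧ C β q s ∧ RR h o β b
  have hSd : Dd (fun v : Fin 3 → El M => S (v 0) (v 1) (v 2)) := by
    refine Dd.ex (Dd.ex (Dd.and ?_ (Dd.and ?_ ?_)))
    · exact Dd.eq (Tm.proj ⟨_, fun _ => rfl⟩) (Tm.op h (Tm.opN h o (Tm.proj ⟨_, fun _ => rfl⟩)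
        (Tm.proj ⟨_, fun _ => rfl⟩)) (Tm.proj ⟨_, fun _ => rfl⟩))
    · simp only [C]
      repeat' first
        | with_reducible refine Dd.ex ?_
        | with_reducible refine Dd.or ?_ ?_
        | with_reducible refine Dd.not ?_
        | with_reducible refine Dd.and ?_ ?_
        | with_reducible refine Dd.mem ?_ ?_
        | with_reducible refine Dd.eq ?_ ?_
        | with_reducible refine Tm.op h ?_ ?_
        | with_reducible exact Tm.const _
        | exact Tm.proj ⟨_, fun _ => rfl⟩
    · exact (dd_RR h o).comp ![0, 3]
  obtain ⟨N, hN⟩ := hM.rep2 S hSd α' P' (by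
    rintro β q hβ hq z z' ⟨b, s, rfl, hC, hR⟩ ⟨b', s', rfl, hC', hR'⟩
    have e1 := RR_unique h o hR hR'
    subst e1
    suffices s = s' by rw [this]
    have key : ∀ s : El M, (op h β (op h s q)).1 ∈ f'.1 →
        ∃ σ p : El M, (op h β (op h σ p)).1 ∈ f'.1 ∧
      p.1 ∈ P'.1 ∧ ∃ t : El M, t.1 ∈ P'.1 ∧ (op h t q).1 ∈ r'.1 ∧ (op h t p).1 ∈ r'.1 :=
      fun s hs => ⟨s, q, hs, hq, q, hq, hrefl _ hq, hrefl _ hq⟩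
    rcases hC with hC | ⟨e, hC⟩ <;> rcases hC' with hC' | ⟨e', hC'⟩
    · exact Subtype.ext (ZFSet.pair_inj.1 (hf3 _ _ _ hC hC')).1
    · exact absurd (key s hC) hC'
    · exact absurd (key s' hC') hC
    · rw [e, e'])
  -- membership in the value of `N`
  have hval : ∀ w, w ∈ zval G N.1 ↔ ∃ β q s : El M, β.1 ∈ α ∧ q.1 ∈ G ∧ C β q s ∧
      w = ZFSet.pair β.1 (zval G s.1) := by
    intro w
    rw [mem_zval]
    constructor
    · rintro ⟨n, p, hp, hm, rfl⟩
      obtain ⟨β, q, hβ, hq, b, s, e, hC, hR⟩ := (hN ⟨_, hM.trans.mem_trans hm N.2⟩).1 hm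
      obtain ⟨e1, e2⟩ := ZFSet.pair_inj.1 (Subtype.ext_iff.1 e)
      refine ⟨β, q, s, hβ, e2 ▸ hp, hC, ?_⟩
      rw [e1, zval_opN h o _ _ ho, RR_val h o ho hR]
    · rintro ⟨β, q, s, hβ, hq, hC, rfl⟩
      obtain ⟨b, hb⟩ := RR_exists hM o β.1 β rfl
        ⟨hord.2 _ hβ, fun c hc => hord.2 _ (hord.1.mem_trans hc hβ)⟩
      refine ⟨(opN h o b s).1, q.1, hq, (hN (op h (opN h o b s) q)).2
        ⟨β, q, hβ, hGP hq, b, s, rfl, hC, hb⟩, ?_⟩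
      rw [zval_opN h o _ _ ho, RR_val h o ho hb]
  have hCX : ∀ β q s : El M, q.1 ∈ G → C β q s → zval G s.1 ∈ zval G τ := by
    rintro β q s hq (hC | ⟨rfl, hC⟩)
    · obtain ⟨x, hx, y, hy, e⟩ := hf1 _ hC
      have := (ZFSet.pair_inj.1 e).2
      exact mem_zval.2 ⟨s.1, q.1, hq, by rw [← this] at hy; exact hy, rfl⟩
    · rw [← e0]; exact hx0
  obtain ⟨a, ha⟩ := RR_exists hM o α α' rfl hord
  refine ⟨α, mem_genExt.2 ⟨a.1, a.2, RR_val h o ho ha⟩, zval G N.1,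
    mem_genExt.2 ⟨N.1, N.2, rfl⟩, hord, ?_, ?_, ?_, ?_⟩
  · intro z hz
    obtain ⟨β, q, s, hβ, hq, hC, rfl⟩ := (hval z).1 hz
    exact ⟨β.1, hβ, _, hCX β q s hq hC, rfl⟩
  · intro β hβ
    have hβM := hM.trans.mem_trans hβ hα
    suffices ∃ q s : El M, q.1 ∈ G ∧ C ⟨β, hβM⟩ q s by
      obtain ⟨q, s, hq, hC⟩ := this
      exact ⟨_, hCX _ q s hq hC, (hval _).2 ⟨⟨β, hβM⟩, q, s, hβ, hq, hC, rfl⟩⟩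
    obtain ⟨t, ht, htf⟩ := hf2 β hβ
    by_cases h1 : ∃ σ p, t = ZFSet.pair σ p ∧ p ∈ P
    · obtain ⟨σ, p, rfl, hp⟩ := h1
      by_cases hpG : p ∈ G
      · exact ⟨⟨p, hPM hp⟩, ⟨σ, (hτM ht).1⟩, hpG, Or.inl htf⟩
      · obtain ⟨q, hq, hi⟩ := hincompat hp hpG
        refine ⟨⟨q, hPM (hGP hq)⟩, s0, hq, Or.inr ⟨rfl, ?_⟩⟩
        rintro ⟨σ', p', h2, h3, t, h4, h5, h6⟩
        have := (ZFSet.pair_inj.1 (hf3 _ _ _ h2 htf)).2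
        change p'.1 = p at this
        change ZFSet.pair t.1 p'.1 ∈ r at h6
        rw [this] at h6
        exact hi ⟨t.1, h4, h5, h6⟩
    · refine ⟨o, s0, ho, Or.inr ⟨rfl, ?_⟩⟩
      rintro ⟨σ', p', h2, h3, -⟩
      exact h1 ⟨σ'.1, p'.1, hf3 _ _ _ htf h2, h3⟩
  · intro x y y' hy hy'
    obtain ⟨β, q, s, hβ, hq, hC, e⟩ := (hval _).1 hy
    obtain ⟨β', q', s', hβ', hq', hC', e'⟩ := (hval _).1 hy'
    obtain ⟨rfl, rfl⟩ := ZFSet.pair_inj.1 e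
    obtain ⟨eb, rfl⟩ := ZFSet.pair_inj.1 e'
    have eb' : β = β' := Subtype.ext eb
    subst eb'
    have key : ∀ (q q' : El M), q.1 ∈ G → q'.1 ∈ G → ∀ s : El M,
        (op h β (op h s q)).1 ∈ f'.1 →
        ∃ σ p : El M, (op h β (op h σ p)).1 ∈ f'.1 ∧
      p.1 ∈ P'.1 ∧ ∃ t : El M, t.1 ∈ P'.1 ∧ (op h t q').1 ∈ r'.1 ∧ (op h t p).1 ∈ r'.1 := by
      intro q q' hq hq' s hs
      obtain ⟨t, ht, h1, h2⟩ := hGdir _ hq' _ hq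
      exact ⟨s, q, hs, hGP hq, ⟨t, hPM (hGP ht)⟩, hGP ht, h1, h2⟩
    rcases hC with hC | ⟨e, hC⟩ <;> rcases hC' with hC' | ⟨e', hC'⟩
    · have := (ZFSet.pair_inj.1 (hf3 _ _ _ hC hC')).1
      exact congrArg (zval G) this
    · exact absurd (key q q' hq hq' s hC) hC'
    · exact absurd (key q' q hq' hq s' hC') hC
    · rw [e, e']
  · intro y hy
    obtain ⟨σ, p, hp, hm, rfl⟩ := mem_zval.1 hy
    obtain ⟨β, hβ, hb⟩ := hf4 _ hm
    exact ⟨β, hβ, (hval _).2 ⟨⟨β, hM.trans.mem_trans hβ hα⟩, ⟨p, (hτM hm).2⟩,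
      ⟨σ, (hτM hm).1⟩, hβ, hp, Or.inl hb, rfl⟩⟩

/-- the generic extension of a ctm of `ZFC` models `AC`. -/
theorem genExt_models_AC (M : ZFSet) (hcount : M.toSet.Countable)
    (htrans : M.IsTransitive) (hmodel : ZModels M (ZF ∪ {acAx}))
    (P r one : ZFSet) (hforcing : ForcingNotion M P r one)
    (G : ZFSet) (hG : IsGeneric M r P G) :
    ZModels (genExt M G) {acAx} := by
  have hZF : ZModels M ZF := fun φ hφ => hmodel φ (Or.inl hφ)
  have hM := mod_of_models htrans hZF
  have hac := (rz_ac hM.toTP).1 (hmodel acAx (Or.inr rfl))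
  have hone : one ∈ G := by
    have hfo := hforcing
    obtain ⟨hP, hr, honeP, hrel, hrefl, htr, hmax⟩ := hfo
    obtain ⟨q, hq, hqP⟩ := hG.2 P hP ⟨fun x hx => hx, fun p hp => ⟨p, hp, hrefl p hp⟩⟩
    exact hG.1.2.1 q hq one honeP (hmax q hqP)
  have hoM : one ∈ M := htrans.mem_trans hforcing.2.2.1 hforcing.1
  intro φ hφ
  rw [Set.mem_singleton_iff] at hφ
  subst hφ
  exact (rz_ac (tp_genExt hM.toTP ⟨one, hoM⟩ hone)).2 (main_aux hM hforcing hG hac hone)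

end CtmForcing
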